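/- The multifidelity variance factor satisfies (√(1−ρ²) + √(wρ²))² < 1 if and only if ρ² > 4w/(1+w)², for 0 < w < 1 and 0 ≤ ρ² ≤ 1. Equivalently, the multifidelity Monte Carlo estimator has strictly smaller variance than standard Monte Carlo exactly when ρ² > 4w/(1+w)². -/

import Mathlib

theorem stmt16 (w ρ : ℝ) (hw : 0 < w) (hw1 : w < 1) (hρ : ρ ^ 2 ≤ 1) :
    (Real.sqrt (1 - ρ ^ 2) + Real.sqrt (w * ρ ^ 2)) ^ 2 < 1
      ↔ ρ ^ 2 > 4 * w / (1 + w) ^ 2 := by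
  have hx : 0 ≤ ρ ^ 2 := sq_nonneg ρ
  generalize ρ ^ 2 = x at hρ hx ⊢
  have ha : √(1 - x) ^ 2 = 1 - x := Real.sq_sqrt (by linarith)
  have hb : √(w * x) ^ 2 = w * x := Real.sq_sqrt (by positivity)
  have expand : (√(1 - x) + √(w * x)) ^ 2 < 1 ↔
      2 * (√(1 - x) * √(w * x)) < (1 - w) * x := by
    rw [add_sq, ha, hb]
    constructor <;> intro h <;> linarith
  have square : (2 * (√(1 - x) * √(w * x))) ^ 2 = 4 * w * (1 - x) * x := by
    rw [mul_pow, mul_pow, ha, hb]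
    ring
  rw [expand, ← sq_lt_sq₀ (by positivity) (mul_nonneg (by linarith) hx), square,
    gt_iff_lt, div_lt_iff₀ (by positivity)]
  constructor
  · intro h
    have : 0 < x * (x * (1 + w) ^ 2 - 4 * w) := by linarith
    linarith [pos_of_mul_pos_right this hx]
  · intro h
    have hx' : 0 < x := pos_of_mul_pos_left (by linarith) (sq_nonneg (1 + w))
    have : 0 < x * (x * (1 + w) ^ 2 - 4 * w) := mul_pos hx' (by linarith)
    linarith
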